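/- Let V be a real vector space, M ⊆ V a nonempty convex set whose affine span is all of V, and ≽ a preorder on M satisfying SI, with positive cone C = {λ•(x − y) : λ > 0, x, y ∈ M, x ≽ y}. Then ≽ satisfies CD (countable domination) if and only if there is a countable set S ⊆ C that is cofinal in C, i.e., for every v ∈ C there exists s ∈ S with s − v ∈ C. -/

import Mathlib

open Cardinal

variable {V : Type*} [AddCommGroup V] [Module ℝ V]

/-- `u : V → ℝ` is mixture preserving on the convex set `M`. -/
def MixPres (M : Set V) (u : V → ℝ) : Prop :=
  ∀ x ∈ M, ∀ y ∈ M, ∀ α : ℝ, 0 ≤ α → α ≤ 1 →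
    u (α • x + (1 - α) • y) = α * u x + (1 - α) * u y

/-- Axiom MR: existence of a mixture-preserving multi-representation of `r` on `M`. -/
def AxMR (M : Set V) (r : V → V → Prop) : Prop :=
  ∃ U : Set (V → ℝ), U.Nonempty ∧ (∀ u ∈ U, MixPres M u) ∧
    ∀ x ∈ M, ∀ y ∈ M, (r x y ↔ ∀ u ∈ U, u x ≥ u y)

/-- Axiom MC (mixture continuity). -/
def AxMC (M : Set V) (r : V → V → Prop) : Prop :=
  ∀ x ∈ M, ∀ y ∈ M, ∀ z ∈ M,
    (∀ α : ℝ, 0 < α → α ≤ 1 →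
      r (α • x + (1 - α) • y) z ∧ ¬ r z (α • x + (1 - α) • y)) →
    r y z

/-- Axiom SI (strong independence). -/
def AxSI (M : Set V) (r : V → V → Prop) : Prop :=
  ∀ x ∈ M, ∀ y ∈ M, ∀ z ∈ M, ∀ α : ℝ, 0 < α → α < 1 →
    (r x y ↔ r (α • x + (1 - α) • z) (α • y + (1 - α) • z))

/-- Axiom CD (countable domination). -/
def AxCD (M : Set V) (r : V → V → Prop) : Prop :=
  ∃ D : Set (V × V), D.Countable ∧
    (∀ p ∈ D, p.1 ∈ M ∧ p.2 ∈ M ∧ r p.1 p.2) ∧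
    ∀ s ∈ M, ∀ t ∈ M, r s t →
      ∃ p ∈ D, ∃ α : ℝ, 0 < α ∧ α < 1 ∧
        r (α • p.1 + (1 - α) • t) (α • p.2 + (1 - α) • s)

/-- Axiom SD (singleton domination). -/
def AxSD (M : Set V) (r : V → V → Prop) : Prop :=
  ∃ x ∈ M, ∃ y ∈ M, r x y ∧
    ∀ s ∈ M, ∀ t ∈ M, r s t →
      ∃ α : ℝ, 0 < α ∧ α < 1 ∧
        r (α • x + (1 - α) • t) (α • y + (1 - α) • s)

/-- The positive cone of the preorder `r` on `M`. -/
def posCone (M : Set V) (r : V → V → Prop) : Set V :=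
  {v | ∃ l : ℝ, 0 < l ∧ ∃ x ∈ M, ∃ y ∈ M, r x y ∧ v = l • (x - y)}

/-- A set is algebraically closed. -/
def AlgClosed (S : Set V) : Prop :=
  ∀ v w : V, (∀ α : ℝ, 0 < α → α ≤ 1 → (1 - α) • v + α • w ∈ S) → v ∈ S

/-- The weak topology on a real vector space: the coarsest topology making all
linear functionals continuous. -/
def weakTop (W : Type*) [AddCommGroup W] [Module ℝ W] : TopologicalSpace W :=
  ⨅ f : W →ₗ[ℝ] ℝ, TopologicalSpace.induced (⇑f) inferInstance

/-- The linear span of the set of differences of elements of `M`. -/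
def diffSpan (M : Set V) : Submodule ℝ V :=
  Submodule.span ℝ {v | ∃ x ∈ M, ∃ y ∈ M, v = x - y}

/-- `u` is strictly increasing for `r` on `M`. -/
def StrIncr (M : Set V) (r : V → V → Prop) (u : V → ℝ) : Prop :=
  (∀ x ∈ M, ∀ y ∈ M, r x y → u x ≥ u y) ∧
  (∀ x ∈ M, ∀ y ∈ M, r x y → ¬ r y x → u x > u y)

theorem smul_mem_posCone {M : Set V} {r : V → V → Prop} {v : V} (hv : v ∈ posCone M r)
    {c : ℝ} (hc : 0 < c) : c • v ∈ posCone M r := by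
  obtain ⟨l, hl, x, hx, y, hy, hxy, rfl⟩ := hv
  exact ⟨c * l, mul_pos hc hl, x, hx, y, hy, hxy, smul_smul c l (x - y)⟩

theorem sub_mem_posCone {M : Set V} {r : V → V → Prop} {x y : V} (hx : x ∈ M) (hy : y ∈ M)
    (h : r x y) : x - y ∈ posCone M r :=
  ⟨1, one_pos, x, hx, y, hy, h, (one_smul ℝ _).symm⟩

theorem mix_mem {M : Set V} (hconv : Convex ℝ M) {x y : V} (hx : x ∈ M) (hy : y ∈ M)
    {α : ℝ} (h0 : 0 < α) (h1 : α < 1) : α • x + (1 - α) • y ∈ M :=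
  hconv hx hy h0.le (sub_pos.2 h1).le (by ring)

theorem AxSI.mix_right {M : Set V} {r : V → V → Prop} (hSI : AxSI M r)
    {x y z : V} (hx : x ∈ M) (hy : y ∈ M) (hz : z ∈ M) {α : ℝ} (h0 : 0 < α) (h1 : α < 1)
    (h : r x y) : r (α • z + (1 - α) • x) (α • z + (1 - α) • y) := by
  have h2 := (hSI x hx y hy z hz (1 - α) (by linarith) (by linarith)).1 h
  rwa [sub_sub_cancel, add_comm, add_comm _ (α • z)] at h2

theorem AxSI.rel_of_sub_mem_posCone {M : Set V} {r : V → V → Prop} (hSI : AxSI M r)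
    {x y : V} (hx : x ∈ M) (hy : y ∈ M) (h : x - y ∈ posCone M r) : r x y := by
  obtain ⟨l, hl, a, ha, b, hb, hab, hxy⟩ := h
  have hl1 : 0 < 1 + l := by linarith
  have h0 : 0 < 1 / (1 + l) := by positivity
  have h1 : 1 / (1 + l) < 1 := by rw [div_lt_one hl1]; linarith
  have key := hSI.mix_right ha hb hy h0 h1 hab
  have hx' : x = y + l • (a - b) := by rw [← hxy]; abel
  have heq : (1 / (1 + l)) • y + (1 - 1 / (1 + l)) • a
      = (1 / (1 + l)) • x + (1 - 1 / (1 + l)) • b := by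
    rw [hx']
    match_scalars <;> field_simp <;> ring
  rw [heq] at key
  exact (hSI x hx y hy b hb _ h0 h1).2 key

theorem AxSI.add_mem_posCone {M : Set V} {r : V → V → Prop} (hSI : AxSI M r)
    (hconv : Convex ℝ M)
    (htrans : ∀ x ∈ M, ∀ y ∈ M, ∀ z ∈ M, r x y → r y z → r x z)
    {v w : V} (hv : v ∈ posCone M r) (hw : w ∈ posCone M r) : v + w ∈ posCone M r := by
  obtain ⟨l, hl, x, hx, y, hy, hxy, rfl⟩ := hv
  obtain ⟨m, hm, s, hs, t, ht, hst, rfl⟩ := hw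
  have hlm : 0 < l + m := by linarith
  have h0 : 0 < l / (l + m) := by positivity
  have h1 : l / (l + m) < 1 := by rw [div_lt_one hlm]; linarith
  refine ⟨l + m, hlm, _, mix_mem hconv hx hs h0 h1, _, mix_mem hconv hy ht h0 h1,
    htrans _ (mix_mem hconv hx hs h0 h1) _ (mix_mem hconv hy hs h0 h1) _
      (mix_mem hconv hy ht h0 h1)
      ((hSI x hx y hy s hs _ h0 h1).1 hxy) (hSI.mix_right hs ht hy h0 h1 hst), ?_⟩
  match_scalars <;> field_simp <;> ring

theorem stmt_10 (M : Set V) (hM : M.Nonempty) (hconv : Convex ℝ M)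
    (haff : affineSpan ℝ M = ⊤)
    (r : V → V → Prop) (hrefl : ∀ x ∈ M, r x x)
    (htrans : ∀ x ∈ M, ∀ y ∈ M, ∀ z ∈ M, r x y → r y z → r x z)
    (hSI : AxSI M r) :
    AxCD M r ↔
      ∃ S : Set V, S.Countable ∧ S ⊆ posCone M r ∧
        ∀ v ∈ posCone M r, ∃ s ∈ S, s - v ∈ posCone M r := by
  constructor
  · rintro ⟨D, hD, hDM, hdom⟩
    refine ⟨(fun q : (V × V) × ℕ => ((q.2 : ℝ) + 1) • (q.1.1 - q.1.2)) '' (D ×ˢ Set.univ),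
      (hD.prod Set.countable_univ).image _, ?_, ?_⟩
    · rintro _ ⟨⟨p, n⟩, ⟨hp, -⟩, rfl⟩
      obtain ⟨h1, h2, h3⟩ := hDM p hp
      exact smul_mem_posCone (sub_mem_posCone h1 h2 h3) n.cast_add_one_pos
    · rintro _ ⟨l, hl, s, hs, t, ht, hst, rfl⟩
      obtain ⟨p, hp, α, h0, h1, hr⟩ := hdom s hs t ht hst
      obtain ⟨hp1, hp2, hp3⟩ := hDM p hp
      have hα : 0 < 1 - α := by linarith
      obtain ⟨n, hn⟩ := exists_nat_ge (l * α / (1 - α))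
      refine ⟨_, ⟨(p, n), ⟨hp, Set.mem_univ _⟩, rfl⟩, ?_⟩
      have hmix := smul_mem_posCone (sub_mem_posCone (mix_mem hconv hp1 ht h0 h1)
        (mix_mem hconv hp2 hs h0 h1) hr) (div_pos hl hα)
      have hrest := smul_mem_posCone (sub_mem_posCone hp1 hp2 hp3)
        (show 0 < (n : ℝ) + 1 - l * α / (1 - α) by linarith)
      convert hSI.add_mem_posCone hconv htrans hmix hrest using 1
      match_scalars <;> field_simp <;> ring
  · rintro ⟨S, hS, hSC, hcof⟩
    replace hSC : ∀ v ∈ S, v ∈ posCone M r := fun _ hv => hSC hv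
    choose! l hl x hx y hy hxy heq using hSC
    refine ⟨(fun v => (x v, y v)) '' S, hS.image _, ?_, ?_⟩
    · rintro _ ⟨v, hv, rfl⟩
      exact ⟨hx v hv, hy v hv, hxy v hv⟩
    · intro s hs t ht hst
      obtain ⟨v, hv, hvs⟩ := hcof _ (sub_mem_posCone hs ht hst)
      have hlv := hl v hv
      have hl1 : 0 < 1 + l v := by linarith
      have h0 : 0 < l v / (1 + l v) := by positivity
      have h1 : l v / (1 + l v) < 1 := by rw [div_lt_one hl1]; linarith
      refine ⟨_, ⟨v, hv, rfl⟩, l v / (1 + l v), h0, h1,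
        hSI.rel_of_sub_mem_posCone (mix_mem hconv (hx v hv) ht h0 h1)
          (mix_mem hconv (hy v hv) hs h0 h1) ?_⟩
      rw [heq v hv] at hvs
      have hscaled := smul_mem_posCone hvs (one_div_pos.2 hl1)
      convert hscaled using 1
      match_scalars <;> field_simp <;> ring
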